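/- Let m ≥ 2 and γ ⊢_o m. Then f_0(f_0(γ)) = f_1(γ) if and only if r_0(γ) = r_1(γ) or r_0(γ) = r_1(γ) − 1, where r_0(γ) and r_1(γ) are the first-column hook lengths of γ in the rows containing the unique odd 1-hook and the unique odd 2-hook of γ, respectively. -/

import Mathlib

namespace OddSym

open scoped Classical

/-- Remove one box from a row of size `p` (as multisets of parts). -/
def removeBox (lam : Multiset ℕ) (p : ℕ) : Multiset ℕ :=
  if p ≤ 1 then lam.erase p else (p - 1) ::ₘ lam.erase p

lemma removeBox_sum_lt {lam : Multiset ℕ} {p : ℕ} (hp : p ∈ lam) (h0 : 0 < p) :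
    (removeBox lam p).sum < lam.sum := by
  have h : p + (lam.erase p).sum = lam.sum := by
    conv_rhs => rw [← Multiset.cons_erase hp]
    simp [Multiset.sum_cons]
  unfold removeBox
  split
  · omega
  · simp only [Multiset.sum_cons]
    omega

/-- The number of standard Young tableaux of shape `lam`
(equivalently, the degree of the irreducible character of the symmetric
group labelled by `lam`), defined via the branching rule. -/
def degSYT (lam : Multiset ℕ) : ℕ :=
  if _h : lam = 0 then 1
  else ∑ p ∈ (lam.toFinset.filter (fun p => 0 < p)).attach, degSYT (removeBox lam p.1)
termination_by lam.sum
decreasing_by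
  have hp := p.2
  simp only [Finset.mem_filter, Multiset.mem_toFinset] at hp
  exact removeBox_sum_lt hp.1 hp.2

/-- `lam` is an odd partition: all parts positive and the number of standard
Young tableaux of shape `lam` (= the character degree) is odd. -/
def OddP (lam : Multiset ℕ) : Prop :=
  (∀ x ∈ lam, 0 < x) ∧ Odd (degSYT lam)

/-- The parts of `lam` sorted in weakly decreasing order. -/
def descList (lam : Multiset ℕ) : List ℕ :=
  (lam.sort (· ≤ ·)).reverse

/-- The beta-set (set of beta-numbers) of `lam` with `m` beads:
`{ lam_i + (m - i) : 1 ≤ i ≤ m }` where `lam` is padded with zero parts. -/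
def betaSet (lam : Multiset ℕ) (m : ℕ) : Finset ℕ :=
  (Finset.range m).image (fun i => (descList lam).getD i 0 + (m - 1 - i))

/-- `mu` is obtained from `lam` by removing an `e`-hook: in some beta-set of
`lam` a beta-number `x` is replaced by `x - e` (which is not a beta-number). -/
def IsHookRemoval (e : ℕ) (lam mu : Multiset ℕ) : Prop :=
  (∀ x ∈ lam, 0 < x) ∧ (∀ x ∈ mu, 0 < x) ∧ 0 < e ∧
  ∃ m x, Multiset.card lam ≤ m ∧ Multiset.card mu ≤ m ∧
    x ∈ betaSet lam m ∧ e ≤ x ∧ x - e ∉ betaSet lam m ∧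
    betaSet mu m = insert (x - e) ((betaSet lam m).erase x)

/-- The map `f_k` : for an odd partition `lam` with `2^k ≤ |lam|`, the unique
odd partition obtained from `lam` by removing a `2^k`-hook (junk value `0` if
no such partition exists). -/
noncomputable def fkOp (k : ℕ) (lam : Multiset ℕ) : Multiset ℕ :=
  if h : ∃ mu, IsHookRemoval (2 ^ k) lam mu ∧ OddP mu then h.choose else 0

/-- The partition encoded by a finite beta-set: each bead contributes a part
equal to the number of gaps below it. -/
def partOfBeta (S : Finset ℕ) : Multiset ℕ :=
  (S.val.map (fun b => b - (S.filter (fun a => a < b)).card)).filter (fun p => 0 < p)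

/-- The 2-quotient `(lam_0, lam_1)` of `lam`, computed from a beta-set with an
even number of beads via the two runners of the 2-abacus. -/
def quot2 (lam : Multiset ℕ) : Multiset ℕ × Multiset ℕ :=
  (partOfBeta (((betaSet lam (2 * Multiset.card lam)).filter (fun b => b % 2 = 0)).image
      (fun b => b / 2)),
   partOfBeta (((betaSet lam (2 * Multiset.card lam)).filter (fun b => b % 2 = 1)).image
      (fun b => b / 2)))

/-- The `e`-core of `lam`: push all beads of an `e`-abacus configuration for
`lam` up as far as possible. -/
def coreP (e : ℕ) (lam : Multiset ℕ) : Multiset ℕ :=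
  partOfBeta ((Finset.range (e * (Multiset.card lam + e))).filter
    (fun x => x / e <
      ((betaSet lam (Multiset.card lam + e)).filter (fun b => b % e = x % e)).card))

/-- Row `k` of the 2-quotient tower of `lam`: row 0 is `[lam]`, and row `k+1`
replaces each entry of row `k` by its 2-quotient pair. -/
def towerRow : ℕ → Multiset ℕ → List (Multiset ℕ)
  | 0, lam => [lam]
  | (k + 1), lam => (towerRow k lam).flatMap (fun mu => [(quot2 mu).1, (quot2 mu).2])

/-- `R_k^j(lam)`: the component of row `k` of the 2-quotient tower of `lam`
from which a `2^(j-k)`-hook is removed in the passage from `lam` to `f_j(lam)`;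
it is characterized by: row `k` for `f_j(lam)` is obtained from row `k` for
`lam` by replacing this component by its image under `f_(j-k)`. -/
noncomputable def Rcomp (k j : ℕ) (lam : Multiset ℕ) : Multiset ℕ :=
  if h : ∃ s, s < 2 ^ k ∧
      towerRow k (fkOp j lam) =
        (towerRow k lam).set s (fkOp (j - k) ((towerRow k lam).getD s 0))
  then (towerRow k lam).getD h.choose 0 else 0


/-- `r_k(lam)`: the first-column hook length of `lam` in the row containing the
unique odd `2^k`-hook, read off from the normalized beta-set of `lam`
(the beta-number that is decreased by `2^k` in the passage to `f_k(lam)`). -/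
noncomputable def rkVal (k : ℕ) (lam : Multiset ℕ) : ℕ :=
  if h : ∃ x, x ∈ betaSet lam (Multiset.card lam) ∧ 2 ^ k ≤ x ∧
      betaSet (fkOp k lam) (Multiset.card lam) =
        insert (x - 2 ^ k) ((betaSet lam (Multiset.card lam)).erase x)
  then h.choose else 0

/-- Move the bead `x` of `X` down by `e` positions. -/
def beadMove (X : Finset ℕ) (x e : ℕ) : Finset ℕ := insert (x - e) (X.erase x)

/-- The beads of `X` that can be moved down by `e` positions. -/
def movable (X : Finset ℕ) (e : ℕ) : Finset ℕ := X.filter (fun x => e ≤ x ∧ x - e ∉ X)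

lemma mem_beadMove {X : Finset ℕ} {x e y : ℕ} :
    y ∈ beadMove X x e ↔ y = x - e ∨ (y ≠ x ∧ y ∈ X) := by
  simp [beadMove]

lemma mem_movable {X : Finset ℕ} {x e : ℕ} :
    x ∈ movable X e ↔ x ∈ X ∧ e ≤ x ∧ x - e ∉ X := by
  simp [movable]

lemma eq_of_beadMove_eq {X : Finset ℕ} {e x y : ℕ} (he : 0 < e) (hx : x ∈ movable X e)
    (h : beadMove X x e = beadMove X y e) : x = y := by
  have h1 : x ∉ beadMove X x e := by
    rw [mem_movable] at hx
    rw [mem_beadMove]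
    omega
  rw [h, mem_beadMove] at h1
  rw [mem_movable] at hx
  tauto

lemma card_beadMove {X : Finset ℕ} {e x : ℕ} (hx : x ∈ movable X e) :
    (beadMove X x e).card = X.card := by
  rw [mem_movable] at hx
  rw [beadMove, Finset.card_insert_of_notMem (by simp [hx.2.2]), Finset.card_erase_add_one hx.1]

lemma sum_beadMove {X : Finset ℕ} {e x : ℕ} (hx : x ∈ movable X e) :
    (∑ b ∈ beadMove X x e, b) + e = ∑ b ∈ X, b := by
  rw [mem_movable] at hx
  rw [beadMove, Finset.sum_insert (by simp [hx.2.2]), ← Finset.add_sum_erase X (fun b => b) hx.1]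
  omega

/-- Over `ZMod 2`, moving two beads by `e` amounts to moving one bead by `2 * e`. -/
lemma sum_beadMove_beadMove (f : Finset ℕ → ZMod 2) {e : ℕ} (he : 0 < e) (X : Finset ℕ) :
    ∑ x ∈ movable X e, ∑ y ∈ movable (beadMove X x e) e, f (beadMove (beadMove X x e) y e) =
      ∑ x ∈ movable X (2 * e), f (beadMove X x (2 * e)) := by
  rw [Finset.sum_sigma']
  rw [← Finset.sum_filter_add_sum_filter_not _
    (fun p : (_ : ℕ) × ℕ => p.2 + e = p.1 ∨ p.1 + e = p.2)]
  have hzero : ∑ p ∈ ((movable X e).sigma fun x => movable (beadMove X x e) e).filter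
      (fun p : (_ : ℕ) × ℕ => ¬ (p.2 + e = p.1 ∨ p.1 + e = p.2)),
      f (beadMove (beadMove X p.1 e) p.2 e) = 0 := by
    refine Finset.sum_involution (fun p _ => ⟨p.2, p.1⟩) ?_ ?_ ?_ ?_
    · rintro ⟨x, y⟩ hp
      simp only [Finset.mem_filter, Finset.mem_sigma, mem_movable, mem_beadMove] at hp
      have : beadMove (beadMove X y e) x e = beadMove (beadMove X x e) y e := by
        ext z
        simp only [mem_beadMove]
        grind
      simp only [this]
      exact CharTwo.add_self_eq_zero _
    · rintro ⟨x, y⟩ hp _ h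
      simp only [Finset.mem_filter, Finset.mem_sigma, mem_movable, mem_beadMove] at hp
      simp only [Sigma.mk.injEq, heq_eq_eq] at h
      grind
    · rintro ⟨x, y⟩ hp
      simp only [Finset.mem_filter, Finset.mem_sigma, mem_movable, mem_beadMove] at hp ⊢
      grind
    · simp
  rw [hzero, add_zero]
  refine Finset.sum_bij' (fun p _ => max p.1 p.2)
    (fun z _ => if z - e ∈ X then ⟨z - e, z⟩ else ⟨z, z - e⟩) ?_ ?_ ?_ ?_ ?_
  · rintro ⟨x, y⟩ hp
    simp only [Finset.mem_filter, Finset.mem_sigma, mem_movable, mem_beadMove] at hp ⊢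
    grind
  · intro z hz
    rw [mem_movable] at hz
    split_ifs with h <;>
    simp only [Finset.mem_filter, Finset.mem_sigma, mem_movable, mem_beadMove] <;> grind
  · rintro ⟨x, y⟩ hp
    simp only [Finset.mem_filter, Finset.mem_sigma, mem_movable, mem_beadMove] at hp ⊢
    grind
  · intro z hz
    rw [mem_movable] at hz
    split_ifs with h <;> simp
  · rintro ⟨x, y⟩ hp
    simp only [Finset.mem_filter, Finset.mem_sigma, mem_movable, mem_beadMove] at hp
    congr 1
    ext z
    simp only [mem_beadMove]
    grind

/-- The number of beads of `X` below position `b`. -/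
def beadsBelow (X : Finset ℕ) (b : ℕ) : ℕ := (X.filter (fun a => a < b)).card

lemma beadsBelow_le (X : Finset ℕ) (b : ℕ) : beadsBelow X b ≤ b := by
  calc beadsBelow X b ≤ (Finset.range b).card :=
        Finset.card_le_card fun a ha => by simp at ha ⊢; exact ha.2
    _ = b := Finset.card_range b

lemma beadsBelow_succ (X : Finset ℕ) (b : ℕ) :
    beadsBelow X (b + 1) = beadsBelow X b + if b ∈ X then 1 else 0 := by
  unfold beadsBelow
  have : X.filter (fun a => a < b + 1) = X.filter (fun a => a < b) ∪ X.filter (fun a => a = b) := by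
    ext a
    simp only [Finset.mem_filter, Finset.mem_union]
    grind
  rw [this, Finset.card_union_of_disjoint
    (Finset.disjoint_filter.2 fun a _ h1 h2 => by omega), Finset.filter_eq']
  split_ifs <;> simp

lemma beadsBelow_add_le (X : Finset ℕ) (b d : ℕ) : beadsBelow X (b + d) ≤ beadsBelow X b + d := by
  induction d with
  | zero => simp
  | succ d ih =>
    rw [← add_assoc, beadsBelow_succ]
    split_ifs <;> omega

lemma sum_beadsBelow (X : Finset ℕ) : ∑ b ∈ X, beadsBelow X b = ∑ i ∈ Finset.range X.card, i := by
  induction X using Finset.induction_on_max with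
  | empty => simp
  | insert a s has ih =>
    have ha : a ∉ s := fun h => lt_irrefl _ (has a h)
    rw [Finset.sum_insert ha, Finset.card_insert_of_notMem ha, Finset.sum_range_succ, ← ih,
      add_comm]
    congr 1
    · refine Finset.sum_congr rfl fun b hb => ?_
      unfold beadsBelow
      congr 1
      ext c
      have := has b hb
      simp only [Finset.mem_filter, Finset.mem_insert]
      grind
    · unfold beadsBelow
      congr 1
      ext c
      simp only [Finset.mem_filter, Finset.mem_insert]
      grind

lemma mem_partOfBeta {X : Finset ℕ} {p : ℕ} :
    p ∈ partOfBeta X ↔ 0 < p ∧ ∃ b ∈ X, b - beadsBelow X b = p := by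
  simp only [partOfBeta, beadsBelow, Multiset.mem_filter, Multiset.mem_map, Finset.mem_val]
  tauto

lemma partOfBeta_pos (X : Finset ℕ) : ∀ p ∈ partOfBeta X, 0 < p :=
  fun _ hp => (mem_partOfBeta.1 hp).1

lemma sum_filter_pos (s : Multiset ℕ) : (s.filter (fun p => 0 < p)).sum = s.sum := by
  induction s using Multiset.induction_on with
  | empty => simp
  | cons a s ih =>
    rcases Nat.eq_zero_or_pos a with h | h
    · simp [h, ih]
    · simp [h, ih]

lemma sum_partOfBeta (X : Finset ℕ) :
    (partOfBeta X).sum + ∑ i ∈ Finset.range X.card, i = ∑ b ∈ X, b := by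
  rw [partOfBeta, sum_filter_pos, ← sum_beadsBelow]
  change ∑ b ∈ X, (b - beadsBelow X b) + _ = _
  rw [← Finset.sum_add_distrib]
  exact Finset.sum_congr rfl fun b _ => Nat.sub_add_cancel (beadsBelow_le X b)

lemma sum_partOfBeta_beadMove {X : Finset ℕ} {e x : ℕ} (hx : x ∈ movable X e) :
    (partOfBeta (beadMove X x e)).sum + e = (partOfBeta X).sum := by
  have h1 := sum_partOfBeta X
  have h2 := sum_partOfBeta (beadMove X x e)
  have h3 := sum_beadMove hx
  rw [card_beadMove hx] at h2
  omega

lemma beadsBelow_lt_of_movable {X : Finset ℕ} {x : ℕ} (hx : x ∈ movable X 1) :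
    beadsBelow X x < x := by
  rw [mem_movable] at hx
  obtain ⟨y, rfl⟩ : ∃ y, x = y + 1 := ⟨x - 1, by omega⟩
  have h := beadsBelow_le X y
  simp only [Nat.add_sub_cancel] at hx
  rw [beadsBelow_succ, if_neg hx.2.2]
  omega

lemma beadsBelow_beadMove_of_ne {X : Finset ℕ} {x b : ℕ} (hx : x ∈ movable X 1) (hb : b ≠ x) :
    beadsBelow (beadMove X x 1) b = beadsBelow X b := by
  have hx' := mem_movable.1 hx
  obtain h | h := Nat.lt_or_gt_of_ne hb
  · unfold beadsBelow
    congr 1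
    ext c
    simp only [Finset.mem_filter, mem_beadMove]
    grind
  · have : (beadMove X x 1).filter (fun a => a < b) = beadMove (X.filter (fun a => a < b)) x 1 := by
      ext c
      simp only [Finset.mem_filter, mem_beadMove]
      grind
    rw [beadsBelow, this, card_beadMove, beadsBelow]
    simp only [mem_movable, Finset.mem_filter]
    tauto

lemma beadsBelow_sub_one {X : Finset ℕ} {x : ℕ} (hx : x ∈ movable X 1) :
    beadsBelow X (x - 1) = beadsBelow X x := by
  rw [mem_movable] at hx
  obtain ⟨y, rfl⟩ : ∃ y, x = y + 1 := ⟨x - 1, by omega⟩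
  simp only [Nat.add_sub_cancel] at hx ⊢
  rw [beadsBelow_succ, if_neg hx.2.2, add_zero]

lemma partOfBeta_beadMove {X : Finset ℕ} {x : ℕ} (hx : x ∈ movable X 1) :
    partOfBeta (beadMove X x 1) = removeBox (partOfBeta X) (x - beadsBelow X x) := by
  have hx' := mem_movable.1 hx
  have hlt := beadsBelow_lt_of_movable hx
  set R : Multiset ℕ :=
    ((X.erase x).val.map (fun b => b - beadsBelow X b)).filter (fun p => 0 < p) with hR
  have h1 : partOfBeta X = (x - beadsBelow X x) ::ₘ R := by
    change (X.val.map (fun b => b - beadsBelow X b)).filter (fun p => 0 < p) = _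
    conv_lhs => rw [← Finset.insert_erase hx'.1]
    rw [Finset.insert_val_of_notMem (Finset.notMem_erase x X), Multiset.map_cons,
      Multiset.filter_cons_of_pos]
    · rw [Finset.insert_erase hx'.1]
    · rw [Finset.insert_erase hx'.1]
      omega
  have h2 : partOfBeta (beadMove X x 1) =
      ((x - beadsBelow X x - 1) ::ₘ
        (X.erase x).val.map (fun b => b - beadsBelow X b)).filter (fun p => 0 < p) := by
    change ((beadMove X x 1).val.map (fun b => b - beadsBelow (beadMove X x 1) b)).filter
      (fun p => 0 < p) = _
    conv_lhs => enter [2, 2]; rw [beadMove]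
    rw [Finset.insert_val_of_notMem (by simp [hx'.2.2]), Multiset.map_cons,
      beadsBelow_beadMove_of_ne hx (by omega), beadsBelow_sub_one hx, Nat.sub_right_comm]
    congr 2
    refine Multiset.map_congr rfl fun b hb => ?_
    rw [beadsBelow_beadMove_of_ne hx]
    exact (Finset.mem_erase.1 hb).1
  rw [h2, h1, removeBox, Multiset.erase_cons_head]
  split_ifs with h
  · rw [Multiset.filter_cons_of_neg _ (by omega)]
  · rw [Multiset.filter_cons_of_pos _ (by omega)]

lemma degSYT_partOfBeta {X : Finset ℕ} (h : (partOfBeta X).sum ≠ 0) :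
    degSYT (partOfBeta X) = ∑ x ∈ movable X 1, degSYT (partOfBeta (beadMove X x 1)) := by
  have h0 : partOfBeta X ≠ 0 := fun h' => h (by rw [h', Multiset.sum_zero])
  rw [degSYT, dif_neg h0, Finset.sum_attach _ (fun p => degSYT (removeBox (partOfBeta X) p))]
  symm
  refine Finset.sum_nbij (fun x => x - beadsBelow X x) ?_ ?_ ?_ ?_
  · intro x hx
    have := beadsBelow_lt_of_movable hx
    simp only [Finset.mem_filter, Multiset.mem_toFinset, mem_partOfBeta]
    exact ⟨⟨by omega, x, (mem_movable.1 hx).1, rfl⟩, by omega⟩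
  · have key : ∀ x y, x < y → y ∈ movable X 1 → x - beadsBelow X x < y - beadsBelow X y := by
      intro x y hxy hy
      have h1 := beadsBelow_sub_one hy
      have h2 := beadsBelow_add_le X x (y - 1 - x)
      rw [show x + (y - 1 - x) = y - 1 by omega] at h2
      have h3 := beadsBelow_le X x
      have h4 := beadsBelow_lt_of_movable hy
      omega
    intro x hx y hy hxy
    by_contra hne
    obtain h | h := Nat.lt_or_gt_of_ne hne
    · exact (key x y h hy).ne hxy
    · exact (key y x h hx).ne hxy.symm
  · intro p hp
    simp only [Finset.coe_filter, Multiset.mem_toFinset, mem_partOfBeta, Set.mem_ofPred_eq] at hp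
    have hex := hp.1.2
    have hs := Nat.find_spec hex
    have hm := fun k => Nat.find_min hex (m := k)
    set b := Nat.find hex
    refine ⟨b, ?_, hs.2⟩
    rw [Finset.mem_coe, mem_movable]
    have hb : 1 ≤ b := by omega
    refine ⟨hs.1, hb, fun hb' => hm (b - 1) (by omega) ⟨hb', ?_⟩⟩
    have h1 := beadsBelow_succ X (b - 1)
    rw [if_pos hb', Nat.sub_add_cancel hb] at h1
    omega
  · intro x hx
    rw [partOfBeta_beadMove hx]

/-- Degrees can be computed modulo `2` by removing `2 ^ k`-hooks. -/
lemma natCast_degSYT_partOfBeta (k : ℕ) {X : Finset ℕ} (h : 2 ^ k ≤ (partOfBeta X).sum) :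
    (degSYT (partOfBeta X) : ZMod 2) =
      ∑ x ∈ movable X (2 ^ k), (degSYT (partOfBeta (beadMove X x (2 ^ k))) : ZMod 2) := by
  induction k generalizing X with
  | zero =>
    rw [degSYT_partOfBeta (by omega)]
    push_cast
    rfl
  | succ k ih =>
    rw [pow_succ'] at h ⊢
    rw [ih (by omega), ← sum_beadMove_beadMove (fun Y => (degSYT (partOfBeta Y) : ZMod 2))
      (Nat.two_pow_pos k)]
    refine Finset.sum_congr rfl fun x hx => ih ?_
    have := sum_partOfBeta_beadMove hx
    omega

lemma exists_movable_odd (k : ℕ) {X : Finset ℕ} (h : 2 ^ k ≤ (partOfBeta X).sum)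
    (hX : Odd (degSYT (partOfBeta X))) :
    ∃ x ∈ movable X (2 ^ k), Odd (degSYT (partOfBeta (beadMove X x (2 ^ k)))) := by
  by_contra! hne
  rw [← ZMod.natCast_eq_one_iff_odd, natCast_degSYT_partOfBeta k h, Finset.sum_eq_zero] at hX
  · exact zero_ne_one hX
  · intro x hx
    rw [ZMod.natCast_eq_zero_iff_even]
    exact Nat.not_odd_iff_even.1 (hne x hx)

lemma movable_le_sum {X : Finset ℕ} {e x : ℕ} (hx : x ∈ movable X e) :
    e ≤ (partOfBeta X).sum := by
  have := sum_partOfBeta_beadMove hx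
  omega

lemma eq_of_mem_movable {X : Finset ℕ} {e x y : ℕ} (h : (partOfBeta X).sum < 2 * e)
    (hx : x ∈ movable X e) (hy : y ∈ movable X e) : x = y := by
  by_contra hne
  have h1 := sum_partOfBeta_beadMove hx
  have h2 : y ∈ movable (beadMove X x e) e := by
    simp only [mem_movable, mem_beadMove] at *
    grind
  have := movable_le_sum h2
  omega

/-- When the partition has a single `e`-hook, removing a box and then an `e`-hook amounts to
removing that `e`-hook and then a box, and the second box determines the first one. -/
lemma exists_beadMove_comm {X : Finset ℕ} {e x y z : ℕ} (he : 0 < e)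
    (h : (partOfBeta X).sum < 2 * e) (hx : x ∈ movable X e) (hy : y ∈ movable X 1)
    (hz : z ∈ movable (beadMove X y 1) e) :
    ∃ w ∈ movable (beadMove X x e) 1,
      beadMove (beadMove X x e) w 1 = beadMove (beadMove X y 1) z e ∧
      (w = x - e ∧ y = x ∨ w = x + 1 ∧ y = x + 1 - e ∨
        w = y ∧ y ≠ x - e ∧ y ≠ x + 1) := by
  have hy' := mem_movable.1 hy
  have hx' := mem_movable.1 hx
  have hz' := mem_movable.1 hz
  simp only [mem_beadMove] at hz'
  have hlarge : ∀ v ∈ movable X (e + 1), x ∉ movable (beadMove X v (e + 1)) e := by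
    intro v hv hxv
    have h1 := sum_partOfBeta_beadMove hv
    have h2 := movable_le_sum hxv
    omega
  by_cases hzy : z = y - 1
  · have hxy : y = x := by
      by_contra hne
      refine hlarge y ?_ ?_ <;> simp only [mem_movable, mem_beadMove] <;> grind
    subst hxy
    refine ⟨y - e, ?_, ?_, Or.inl ⟨rfl, rfl⟩⟩
    · simp only [mem_movable, mem_beadMove]
      grind
    · ext a
      simp only [mem_beadMove]
      grind
  · by_cases hze : z - e = y
    · have hxz : z = x + 1 := by
        by_contra hne
        refine hlarge z ?_ ?_ <;> simp only [mem_movable, mem_beadMove] <;> grind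
      refine ⟨x + 1, ?_, ?_, Or.inr (Or.inl ⟨rfl, by omega⟩)⟩
      · simp only [mem_movable, mem_beadMove]
        grind
      · ext a
        simp only [mem_beadMove]
        grind
    · have hxz : z = x := by
        refine eq_of_mem_movable h ?_ hx
        simp only [mem_movable]
        grind
      subst hxz
      refine ⟨y, ?_, ?_, Or.inr (Or.inr ⟨rfl, ?_, ?_⟩)⟩
      · simp only [mem_movable, mem_beadMove]
        grind
      · ext a
        simp only [mem_beadMove]
        grind
      · grind
      · grind

/-- A partition of odd degree is joined to at most one partition of odd degree below it in the
Young graph. -/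
theorem eq_of_odd_beadMove {X : Finset ℕ} (hX : Odd (degSYT (partOfBeta X))) {y₁ y₂ : ℕ}
    (h₁ : y₁ ∈ movable X 1) (o₁ : Odd (degSYT (partOfBeta (beadMove X y₁ 1))))
    (h₂ : y₂ ∈ movable X 1) (o₂ : Odd (degSYT (partOfBeta (beadMove X y₂ 1)))) : y₁ = y₂ := by
  induction hn : (partOfBeta X).sum using Nat.strong_induction_on generalizing X y₁ y₂ with
  | _ n ih =>
  have hpos := movable_le_sum h₁
  set k := Nat.log 2 n with hk
  have hle : 2 ^ k ≤ n := Nat.pow_log_le_self 2 (by omega)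
  have hlt : n < 2 * 2 ^ k := by
    rw [← pow_succ']
    exact Nat.lt_pow_succ_log_self (by omega) n
  have he : 0 < 2 ^ k := Nat.two_pow_pos k
  obtain ⟨x, hx, ox⟩ := exists_movable_odd k (hn ▸ hle) hX
  have hsx := sum_partOfBeta_beadMove hx
  generalize hek : 2 ^ k = e at *
  obtain rfl | hlt' := hle.eq_or_lt
  · have hsub : (movable X 1).filter (fun y => Odd (degSYT (partOfBeta (beadMove X y 1)))) ⊆
        {x, x - e + 1} := by
      intro y hy
      have hy := (Finset.mem_filter.1 hy).1
      have hy' : y ∉ movable (beadMove X x e) 1 := fun hm => by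
        have := movable_le_sum hm
        omega
      simp only [mem_movable, mem_beadMove, Finset.mem_insert, Finset.mem_singleton] at *
      grind
    have hcard := (Finset.card_le_card hsub).trans Finset.card_le_two
    rw [degSYT_partOfBeta (by omega), Finset.odd_sum_iff_odd_card_odd] at hX
    have h1 : ((movable X 1).filter
        (fun y => Odd (degSYT (partOfBeta (beadMove X y 1))))).card ≤ 1 := by
      obtain ⟨t, ht⟩ := hX
      omega
    exact Finset.card_le_one.1 h1 _ (Finset.mem_filter.2 ⟨h₁, o₁⟩) _ (Finset.mem_filter.2 ⟨h₂, o₂⟩)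
  · have key : ∀ y ∈ movable X 1, Odd (degSYT (partOfBeta (beadMove X y 1))) →
        ∃ w ∈ movable (beadMove X x e) 1,
          Odd (degSYT (partOfBeta (beadMove (beadMove X x e) w 1))) ∧
          (w = x - e ∧ y = x ∨ w = x + 1 ∧ y = x + 1 - e ∨
            w = y ∧ y ≠ x - e ∧ y ≠ x + 1) := by
      intro y hy oy
      have hsy := sum_partOfBeta_beadMove hy
      obtain ⟨z, hz, oz⟩ := exists_movable_odd k (by omega) oy
      rw [hek] at hz oz
      obtain ⟨w, hw, hwz, hwy⟩ := exists_beadMove_comm he (by omega) hx hy hz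
      exact ⟨w, hw, hwz ▸ oz, hwy⟩
    obtain ⟨w₁, hw₁, p₁, q₁⟩ := key y₁ h₁ o₁
    obtain ⟨w₂, hw₂, p₂, q₂⟩ := key y₂ h₂ o₂
    have := ih _ (by omega) ox hw₁ p₁ hw₂ p₂ rfl
    omega

lemma coe_descList (lam : Multiset ℕ) : (descList lam : Multiset ℕ) = lam := by
  rw [descList, Multiset.coe_reverse, Multiset.sort_eq]

lemma length_descList (lam : Multiset ℕ) : (descList lam).length = Multiset.card lam := by
  simp [descList]

lemma pairwise_descList (lam : Multiset ℕ) : (descList lam).Pairwise (· ≥ ·) := by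
  rw [descList, List.pairwise_reverse]
  exact Multiset.pairwise_sort lam _

lemma descList_coe {l : List ℕ} (h : l.Pairwise (· ≥ ·)) : descList (l : Multiset ℕ) = l := by
  refine List.Perm.eq_of_pairwise (fun a b _ _ h1 h2 => le_antisymm h2 h1)
    (pairwise_descList _) h ?_
  rw [← Multiset.coe_eq_coe, coe_descList]

lemma antitone_getD {l : List ℕ} (h : l.Pairwise (· ≥ ·)) : Antitone fun i => l.getD i 0 := by
  intro i j hij
  obtain rfl | hij := hij.eq_or_lt
  · rfl
  by_cases hj : j < l.length
  · have := List.pairwise_iff_getElem.1 h i j (by omega) hj hij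
    simpa [List.getD_eq_getElem?_getD, hj, hij.trans hj] using this
  · simp [List.getD_eq_getElem?_getD, not_lt.1 hj]

lemma betaNumber_strictAnti (lam : Multiset ℕ) {m i j : ℕ} (hij : i < j) (hj : j < m) :
    (descList lam).getD j 0 + (m - 1 - j) < (descList lam).getD i 0 + (m - 1 - i) := by
  have := antitone_getD (pairwise_descList lam) hij.le
  simp only at this
  omega

lemma betaNumber_injOn (lam : Multiset ℕ) (m : ℕ) :
    Set.InjOn (fun i => (descList lam).getD i 0 + (m - 1 - i)) (Finset.range m : Set ℕ) := by
  intro i hi j hj hij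
  rw [Finset.mem_coe, Finset.mem_range] at hi hj
  by_contra hne
  obtain h | h := Nat.lt_or_gt_of_ne hne
  · exact (betaNumber_strictAnti lam h hj).ne hij.symm
  · exact (betaNumber_strictAnti lam h hi).ne hij

lemma card_betaSet (lam : Multiset ℕ) (m : ℕ) : (betaSet lam m).card = m := by
  rw [betaSet, Finset.card_image_of_injOn (betaNumber_injOn lam m), Finset.card_range]

lemma beadsBelow_betaSet (lam : Multiset ℕ) {m i : ℕ} (hi : i < m) :
    beadsBelow (betaSet lam m) ((descList lam).getD i 0 + (m - 1 - i)) = m - 1 - i := by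
  have : (betaSet lam m).filter (fun a => a < (descList lam).getD i 0 + (m - 1 - i)) =
      (Finset.Ioo i m).image (fun i => (descList lam).getD i 0 + (m - 1 - i)) := by
    ext b
    simp only [betaSet, Finset.mem_filter, Finset.mem_image, Finset.mem_range, Finset.mem_Ioo]
    constructor
    · rintro ⟨⟨j, hj, rfl⟩, hlt⟩
      refine ⟨j, ⟨?_, hj⟩, rfl⟩
      by_contra hji
      obtain rfl | hji := (not_lt.1 hji).eq_or_lt
      · exact lt_irrefl _ hlt
      · exact lt_asymm hlt (betaNumber_strictAnti lam hji hi)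
    · rintro ⟨j, ⟨hij, hj⟩, rfl⟩
      exact ⟨⟨j, hj, rfl⟩, betaNumber_strictAnti lam hij hj⟩
  rw [beadsBelow, this, Finset.card_image_of_injOn, Nat.card_Ioo]
  · omega
  · refine (betaNumber_injOn lam m).mono fun j hj => ?_
    rw [Finset.mem_coe, Finset.mem_Ioo] at hj
    rw [Finset.mem_coe, Finset.mem_range]
    exact hj.2

lemma map_range_getD (l : List ℕ) {m : ℕ} (h : l.length ≤ m) :
    (List.range m).map (fun i => l.getD i 0) = l ++ List.replicate (m - l.length) 0 := by
  refine List.ext_getElem (by simp; omega) fun i h1 h2 => ?_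
  simp only [List.getElem_map, List.getElem_range, List.getElem_append, List.getElem_replicate]
  split_ifs with hi
  · simp [List.getD_eq_getElem?_getD, hi]
  · simp [List.getD_eq_getElem?_getD, not_lt.1 hi]

lemma partOfBeta_betaSet {lam : Multiset ℕ} (hpos : ∀ p ∈ lam, 0 < p) {m : ℕ}
    (hm : Multiset.card lam ≤ m) : partOfBeta (betaSet lam m) = lam := by
  have h1 : (betaSet lam m).val.map (fun b => b - beadsBelow (betaSet lam m) b) =
      (Multiset.range m).map (fun i => (descList lam).getD i 0) := by
    conv_lhs => enter [2]; rw [betaSet]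
    rw [Finset.image_val_of_injOn (betaNumber_injOn lam m), Multiset.map_map]
    refine Multiset.map_congr rfl fun i hi => ?_
    rw [Function.comp_apply, beadsBelow_betaSet lam (Multiset.mem_range.1 hi)]
    omega
  change ((betaSet lam m).val.map (fun b => b - beadsBelow (betaSet lam m) b)).filter
    (fun p => 0 < p) = _
  rw [h1, Multiset.range, Multiset.map_coe, map_range_getD _ (by rwa [length_descList]),
    ← Multiset.coe_add, coe_descList, Multiset.filter_add, Multiset.filter_eq_self.2 hpos,
    Multiset.filter_eq_nil.2, add_zero]
  intro p hp
  rw [Multiset.mem_coe] at hp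
  simp [List.eq_of_mem_replicate hp]

lemma getD_filter_pos {l : List ℕ} (h : l.Pairwise (· ≥ ·)) (i : ℕ) :
    (l.filter (fun p => 0 < p)).getD i 0 = l.getD i 0 := by
  induction l generalizing i with
  | nil => simp
  | cons p t ih =>
    rw [List.pairwise_cons] at h
    obtain rfl | hp := Nat.eq_zero_or_pos p
    · have h1 := antitone_getD (List.pairwise_cons.2 h) (Nat.zero_le i)
      have h2 : (0 :: t).filter (fun p => 0 < p) = [] := by
        rw [List.filter_eq_nil_iff]
        intro a ha
        rcases List.mem_cons.1 ha with rfl | ha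
        · simp
        · simpa using h.1 a ha
      simp only [List.getD_cons_zero, Nat.le_zero] at h1
      rw [h2, h1]
      simp
    · rw [List.filter_cons_of_pos (by simpa using hp)]
      cases i with
      | zero => simp
      | succ i => simpa using ih h.2 i

lemma le_orderEmbOfFin {X : Finset ℕ} {m : ℕ} (h : X.card = m) (i : Fin m) :
    (i : ℕ) ≤ X.orderEmbOfFin h i := by
  obtain ⟨i, hi⟩ := i
  induction i with
  | zero => simp
  | succ i ih =>
    have h1 := ih (by omega)
    have h2 : X.orderEmbOfFin h ⟨i, by omega⟩ < X.orderEmbOfFin h ⟨i + 1, hi⟩ := by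
      simp
    simp only at *
    omega

lemma exists_betaSet_eq {X : Finset ℕ} {m : ℕ} (h : X.card = m) :
    ∃ lam : Multiset ℕ, (∀ p ∈ lam, 0 < p) ∧ Multiset.card lam ≤ m ∧ betaSet lam m = X := by
  set l : List ℕ := List.ofFn fun i : Fin m => X.orderEmbOfFin h i.rev - i.rev with hl
  have hlen : l.length = m := by simp [hl]
  have hmono : ∀ i j : Fin m, i ≤ j →
      X.orderEmbOfFin h i - (i : ℕ) ≤ X.orderEmbOfFin h j - (j : ℕ) := by
    have hstep : ∀ d (i : ℕ) (hi : i + d < m), X.orderEmbOfFin h ⟨i, by omega⟩ + d ≤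
        X.orderEmbOfFin h ⟨i + d, hi⟩ := by
      intro d
      induction d with
      | zero => simp
      | succ d ih =>
        intro i hi
        have h1 := ih i (by omega)
        have h2 : X.orderEmbOfFin h ⟨i + d, by omega⟩ < X.orderEmbOfFin h ⟨i + (d + 1), hi⟩ := by
          simp
        omega
    rintro ⟨i, hi⟩ ⟨j, hj⟩ hij
    obtain ⟨d, rfl⟩ := Nat.exists_eq_add_of_le (Fin.mk_le_mk.1 hij)
    have := hstep d i hj
    have := le_orderEmbOfFin h ⟨i, hi⟩
    simp only at *
    omega
  have hsorted : l.Pairwise (· ≥ ·) := by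
    rw [hl, List.pairwise_ofFn]
    intro i j hij
    exact hmono _ _ (Fin.rev_le_rev.2 hij.le)
  refine ⟨(l.filter (fun p => 0 < p) : List ℕ), ?_, ?_, ?_⟩
  · intro p hp
    simpa using (List.mem_filter.1 (Multiset.mem_coe.1 hp)).2
  · rw [Multiset.coe_card, ← hlen]
    exact List.length_filter_le _ _
  · refine Finset.eq_of_subset_of_card_le ?_ (by rw [card_betaSet, h])
    rw [betaSet, descList_coe (hsorted.filter _)]
    intro b hb
    obtain ⟨i, hi, rfl⟩ := Finset.mem_image.1 hb
    rw [Finset.mem_range] at hi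
    rw [getD_filter_pos hsorted, List.getD_eq_getElem _ _ (by omega)]
    have h1 := le_orderEmbOfFin h (Fin.rev ⟨i, hi⟩)
    have h2 : X.orderEmbOfFin h (Fin.rev ⟨i, hi⟩) ∈ X := Finset.orderEmbOfFin_mem _ _ _
    convert h2 using 1
    simp only [hl, List.getElem_ofFn, Fin.val_rev] at h1 ⊢
    omega

lemma card_partOfBeta_le (X : Finset ℕ) : Multiset.card (partOfBeta X) ≤ X.card := by
  rw [partOfBeta]
  refine (Multiset.card_le_card (Multiset.filter_le _ _)).trans ?_
  rw [Multiset.card_map, Finset.card_def]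

lemma betaSet_partOfBeta {X : Finset ℕ} {m : ℕ} (h : X.card = m) :
    betaSet (partOfBeta X) m = X := by
  obtain ⟨lam, hpos, hcard, rfl⟩ := exists_betaSet_eq h
  rw [partOfBeta_betaSet hpos hcard]

/-- Shift all beads up by one position and add a bead at position `0`. -/
def betaShift (S : Finset ℕ) : Finset ℕ := insert 0 (S.image Nat.succ)

lemma zero_mem_betaShift (S : Finset ℕ) : 0 ∈ betaShift S := by simp [betaShift]

lemma succ_mem_betaShift {S : Finset ℕ} {a : ℕ} : a + 1 ∈ betaShift S ↔ a ∈ S := by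
  simp [betaShift]

lemma betaShift_injective : Function.Injective betaShift := by
  intro S T h
  ext a
  rw [← succ_mem_betaShift, h, succ_mem_betaShift]

lemma beadMove_betaShift {S : Finset ℕ} {x e : ℕ} (h : e ≤ x) :
    beadMove (betaShift S) (x + 1) e = betaShift (beadMove S x e) := by
  ext a
  cases a with
  | zero => simp [mem_beadMove, zero_mem_betaShift]
  | succ a =>
    rw [succ_mem_betaShift, mem_beadMove, mem_beadMove, succ_mem_betaShift,
      show a + 1 = x + 1 - e ↔ a = x - e by omega, show a + 1 ≠ x + 1 ↔ a ≠ x by omega]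

lemma mem_movable_betaShift {S : Finset ℕ} {y e : ℕ} (he : 0 < e) :
    y ∈ movable (betaShift S) e ↔ ∃ x ∈ movable S e, y = x + 1 := by
  constructor
  · intro hy
    rw [mem_movable] at hy
    have h0 : y - e ≠ 0 := fun h => hy.2.2 (h ▸ zero_mem_betaShift S)
    obtain ⟨x, rfl⟩ : ∃ x, y = x + 1 := ⟨y - 1, by omega⟩
    rw [succ_mem_betaShift, show x + 1 - e = x - e + 1 by omega, succ_mem_betaShift] at hy
    exact ⟨x, mem_movable.2 ⟨hy.1, by omega, hy.2.2⟩, rfl⟩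
  · rintro ⟨x, hx, rfl⟩
    rw [mem_movable] at hx ⊢
    rw [succ_mem_betaShift, show x + 1 - e = x - e + 1 by omega, succ_mem_betaShift]
    exact ⟨hx.1, by omega, hx.2.2⟩

lemma betaSet_succ {lam : Multiset ℕ} {m : ℕ} (h : Multiset.card lam ≤ m) :
    betaSet lam (m + 1) = betaShift (betaSet lam m) := by
  rw [betaShift, betaSet, Finset.range_add_one, Finset.image_insert, betaSet, Finset.image_image]
  congr 1
  · rw [List.getD_eq_default _ _ (by rwa [length_descList])]
    omega
  · refine Finset.image_congr fun i hi => ?_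
    rw [Finset.mem_coe, Finset.mem_range] at hi
    simp only [Function.comp_apply]
    omega

lemma card_le_of_zero_mem_betaSet {lam : Multiset ℕ} (hpos : ∀ p ∈ lam, 0 < p) {m : ℕ}
    (h : 0 ∈ betaSet lam (m + 1)) : Multiset.card lam ≤ m := by
  by_contra! hlt
  obtain ⟨i, hi, h0⟩ := Finset.mem_image.1 h
  rw [Finset.mem_range] at hi
  rw [← length_descList] at hlt
  rw [List.getD_eq_getElem _ _ (by omega)] at h0
  have h1 : (descList lam)[i]'(by omega) ∈ (descList lam : Multiset ℕ) := List.getElem_mem _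
  rw [coe_descList] at h1
  have := hpos _ h1
  omega

lemma exists_beadMove_succ_iff {lam mu : Multiset ℕ} (hmu : ∀ p ∈ mu, 0 < p) {e m : ℕ}
    (he : 0 < e) (hm : Multiset.card lam ≤ m) :
    (Multiset.card mu ≤ m + 1 ∧ ∃ x ∈ movable (betaSet lam (m + 1)) e,
        betaSet mu (m + 1) = beadMove (betaSet lam (m + 1)) x e) ↔
      (Multiset.card mu ≤ m ∧ ∃ x ∈ movable (betaSet lam m) e,
        betaSet mu m = beadMove (betaSet lam m) x e) := by
  rw [betaSet_succ hm]
  constructor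
  · rintro ⟨-, y, hy, hmove⟩
    obtain ⟨x, hx, rfl⟩ := (mem_movable_betaShift he).1 hy
    rw [beadMove_betaShift (mem_movable.1 hx).2.1] at hmove
    have hcard := card_le_of_zero_mem_betaSet hmu (hmove ▸ zero_mem_betaShift _)
    rw [betaSet_succ hcard] at hmove
    exact ⟨hcard, x, hx, betaShift_injective hmove⟩
  · rintro ⟨hcard, x, hx, hmove⟩
    refine ⟨by omega, x + 1, (mem_movable_betaShift he).2 ⟨x, hx, rfl⟩, ?_⟩
    rw [betaSet_succ hcard, hmove, beadMove_betaShift (mem_movable.1 hx).2.1]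

/-- Hook removal can be read off from the beta-sets with any sufficiently large number of
beads. -/
lemma isHookRemoval_iff {lam mu : Multiset ℕ} (hlam : ∀ p ∈ lam, 0 < p) (hmu : ∀ p ∈ mu, 0 < p)
    {e m : ℕ} (he : 0 < e) (hm : Multiset.card lam ≤ m) :
    IsHookRemoval e lam mu ↔ Multiset.card mu ≤ m ∧
      ∃ x ∈ movable (betaSet lam m) e, betaSet mu m = beadMove (betaSet lam m) x e := by
  have hstep : ∀ n, Multiset.card lam ≤ n →
      ((Multiset.card mu ≤ n ∧ ∃ x ∈ movable (betaSet lam n) e,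
        betaSet mu n = beadMove (betaSet lam n) x e) ↔
      (Multiset.card mu ≤ Multiset.card lam ∧ ∃ x ∈ movable (betaSet lam (Multiset.card lam)) e,
        betaSet mu (Multiset.card lam) = beadMove (betaSet lam (Multiset.card lam)) x e)) := by
    intro n hn
    induction n, hn using Nat.le_induction with
    | base => rfl
    | succ n hn ih => rw [exists_beadMove_succ_iff hmu he hn, ih]
  constructor
  · rintro ⟨-, -, -, n, x, hn, hmn, hx, hex, hxe, hmove⟩
    rw [hstep m hm, ← hstep n hn]
    exact ⟨hmn, x, mem_movable.2 ⟨hx, hex, hxe⟩, hmove⟩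
  · rintro ⟨hmm, x, hx, hmove⟩
    rw [mem_movable] at hx
    exact ⟨hlam, hmu, he, m, x, hm, hmm, hx.1, hx.2.1, hx.2.2, hmove⟩

/-- The map `f_k` on an odd partition, read off from a beta-set with `m` beads. -/
lemma fkOp_spec {lam : Multiset ℕ} (hodd : OddP lam) {k m : ℕ} (hk : 2 ^ k ≤ lam.sum)
    (hm : Multiset.card lam ≤ m) :
    OddP (fkOp k lam) ∧ Multiset.card (fkOp k lam) ≤ m ∧
      ∃ x ∈ movable (betaSet lam m) (2 ^ k),
        betaSet (fkOp k lam) m = beadMove (betaSet lam m) x (2 ^ k) := by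
  have hex : ∃ mu, IsHookRemoval (2 ^ k) lam mu ∧ OddP mu := by
    have hpart := partOfBeta_betaSet hodd.1 hm
    obtain ⟨x, hx, ox⟩ := exists_movable_odd k (hpart.symm ▸ hk) (hpart.symm ▸ hodd.2)
    have hcard : (beadMove (betaSet lam m) x (2 ^ k)).card = m := by
      rw [card_beadMove hx, card_betaSet]
    refine ⟨_, ?_, partOfBeta_pos _, ox⟩
    rw [isHookRemoval_iff hodd.1 (partOfBeta_pos _) (Nat.two_pow_pos k) hm]
    exact ⟨(card_partOfBeta_le _).trans hcard.le, x, hx, betaSet_partOfBeta hcard⟩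
  have hspec : IsHookRemoval (2 ^ k) lam (fkOp k lam) ∧ OddP (fkOp k lam) := by
    rw [fkOp, dif_pos hex]
    exact hex.choose_spec
  exact ⟨hspec.2, (isHookRemoval_iff hodd.1 hspec.2.1 (Nat.two_pow_pos k) hm).1 hspec.1⟩

lemma rkVal_eq {lam : Multiset ℕ} {k x : ℕ}
    (hx : x ∈ movable (betaSet lam (Multiset.card lam)) (2 ^ k))
    (h : betaSet (fkOp k lam) (Multiset.card lam) =
      beadMove (betaSet lam (Multiset.card lam)) x (2 ^ k)) : rkVal k lam = x := by
  have hx' := mem_movable.1 hx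
  have hex : ∃ y, y ∈ betaSet lam (Multiset.card lam) ∧ 2 ^ k ≤ y ∧
      betaSet (fkOp k lam) (Multiset.card lam) =
        insert (y - 2 ^ k) ((betaSet lam (Multiset.card lam)).erase y) := ⟨x, hx'.1, hx'.2.1, h⟩
  rw [rkVal, dif_pos hex]
  exact (eq_of_beadMove_eq (Nat.two_pow_pos k) hx (h.symm.trans hex.choose_spec.2.2)).symm

theorem stmt10 (m : ℕ) (hm : 2 ≤ m) (γ : Multiset ℕ)
    (hodd : OddP γ) (hsum : γ.sum = m) :
    fkOp 0 (fkOp 0 γ) = fkOp 1 γ ↔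
      (rkVal 0 γ = rkVal 1 γ ∨ rkVal 0 γ = rkVal 1 γ - 1) := by
  set N := Multiset.card γ with hN
  obtain ⟨o₁, c₁, a, ha, ea⟩ := fkOp_spec hodd (k := 0) (by omega) hN.ge
  obtain ⟨o₂, c₂, b, hb, eb⟩ := fkOp_spec hodd (k := 1) (by omega) hN.ge
  rw [rkVal_eq ha ea, rkVal_eq hb eb]
  rw [pow_zero] at ha ea
  rw [pow_one] at hb eb
  have hsum₁ : (fkOp 0 γ).sum + 1 = m := by
    rw [← partOfBeta_betaSet o₁.1 c₁, ea, sum_partOfBeta_beadMove ha,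
      partOfBeta_betaSet hodd.1 hN.ge, hsum]
  obtain ⟨o₃, c₃, c, hc, ec⟩ := fkOp_spec o₁ (k := 0) (by omega) c₁
  rw [pow_zero] at hc ec
  have hodd₁ := o₁.2
  have hodd₂ := o₂.2
  have hodd₃ := o₃.2
  rw [← partOfBeta_betaSet o₁.1 c₁, ea] at hodd₁
  rw [← partOfBeta_betaSet o₂.1 c₂, eb] at hodd₂
  rw [← partOfBeta_betaSet o₃.1 c₃, ec, ea] at hodd₃
  rw [ea] at hc ec
  have hiff : fkOp 0 (fkOp 0 γ) = fkOp 1 γ ↔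
      beadMove (beadMove (betaSet γ N) a 1) c 1 = beadMove (betaSet γ N) b 2 := by
    rw [← ec, ← eb]
    refine ⟨fun h => by rw [h], fun h => ?_⟩
    rw [← partOfBeta_betaSet o₃.1 c₃, h, partOfBeta_betaSet o₂.1 c₂]
  rw [hiff]
  generalize betaSet γ N = X at *
  have ha' := mem_movable.1 ha
  have hb' := mem_movable.1 hb
  constructor
  · intro h
    have h1 := fun y => Finset.ext_iff.1 h y
    have h2 := h1 b
    have h3 := h1 (b - 2)
    simp only [mem_movable, mem_beadMove] at hc h2 h3
    grind
  · intro hab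
    obtain ⟨d, hd, hdb⟩ : ∃ d ∈ movable (beadMove X a 1) 1,
        beadMove (beadMove X a 1) d 1 = beadMove X b 2 := by
      obtain rfl | rfl := hab
      · refine ⟨a - 1, ?_, ?_⟩
        · simp only [mem_movable, mem_beadMove]
          grind
        · ext y
          simp only [mem_beadMove]
          grind
      · refine ⟨b, ?_, ?_⟩
        · simp only [mem_movable, mem_beadMove]
          grind
        · ext y
          simp only [mem_beadMove]
          grind
    rw [← hdb] at hodd₂
    rw [eq_of_odd_beadMove hodd₁ hc hodd₃ hd hodd₂, hdb]

end OddSym
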